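/- Fix ω ∈ (0,2π). Define ζ⁰₁ on the closed sector |arg z| ≤ ω/2 minus the origin by −2π ζ⁰₁(z) = (sin ω/(4π)) z² log² z + (sin ω/(4π)) z̄² log² z̄ − ((sin ω + 2π cos ω)/(4π)) z² log z − ((3 sin ω + 2(π − ω) cos ω)/(4π)) z̄² log z̄ − ¼(π sin ω − cos ω) z² + z̄ z log z − z z̄, and define η⁰₁ on the closed sector |arg z₊| ≤ π − ω/2 minus the origin by −2π η⁰₁(z₊) = (sin ω/(4π)) z₊² log² z₊ + (sin ω/(4π)) z̄₊² log² z̄₊ − (sin ω/(4π)) z₊² log z₊ − ((3 sin ω − 2ω cos ω)/(4π)) z̄₊² log z̄₊ − ¼(3 cos ω + (2ω − π) sin ω) z̄₊². Then: ∂_z∂_{z̄} ζ⁰₁(z) = −(1/(2π)) log z for all z ∈ S₋; ∂_{z₊}∂_{z̄₊} η⁰₁(z₊) = 0 for all z₊ with |arg z₊| < π − ω/2; and for all z ∈ Γ, ∂_z ζ⁰₁(z) + (∂_{z₊} η⁰₁)(−z) = 0 and ∂_{z̄} ζ⁰₁(z) + (∂_{z̄₊} η⁰₁)(−z) = 0.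 -/

import Mathlib

open Complex ComplexConjugate Filter Set
open scoped Real

noncomputable section

/-- The Wirtinger derivative `∂_z f = ½(∂_x f − i ∂_y f)`. -/
def wdz (f : ℂ → ℂ) (z : ℂ) : ℂ :=
  (fderiv ℝ f z 1 - I * fderiv ℝ f z I) / 2

/-- The Wirtinger derivative `∂_{z̄} f = ½(∂_x f + i ∂_y f)`. -/
def wdzbar (f : ℂ → ℂ) (z : ℂ) : ℂ :=
  (fderiv ℝ f z 1 + I * fderiv ℝ f z I) / 2

/-- The open sector `S₋ = {r e^{iθ} : r > 0, |θ| < ω/2}`. -/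
def Sminus (ω : ℝ) : Set ℂ := {z | z ≠ 0 ∧ |z.arg| < ω / 2}

/-- The open sector of the variable `z₊ = −z`, i.e. `{z₊ ≠ 0 : |arg z₊| < π − ω/2}`,
corresponding to the interior of `S₊`. -/
def SplusVar (ω : ℝ) : Set ℂ := {z | z ≠ 0 ∧ |z.arg| < π - ω / 2}

/-- The common boundary `Γ = {r e^{±iω/2} : r > 0}`. -/
def Gam (ω : ℝ) : Set ℂ := {z | z ≠ 0 ∧ |z.arg| = ω / 2}

/-- `f` is real-differentiable at `z` with Wirtinger derivatives `∂_z f = a`, `∂_{z̄} f = b`. -/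
def HasWirtinger (f : ℂ → ℂ) (a b z : ℂ) : Prop :=
  HasFDerivAt f (a • (ContinuousLinearMap.id ℝ ℂ) + b • (conjCLE : ℂ →L[ℝ] ℂ)) z

namespace HasWirtinger

variable {f g : ℂ → ℂ} {a b a' b' z : ℂ}

lemma wdz_eq (h : HasWirtinger f a b z) : wdz f z = a := by
  unfold HasWirtinger at h
  rw [wdz, h.fderiv]
  simp
  linear_combination (-a / 2 + b / 2) * I_sq

lemma wdzbar_eq (h : HasWirtinger f a b z) : wdzbar f z = b := by
  unfold HasWirtinger at h
  rw [wdzbar, h.fderiv]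
  simp
  linear_combination (a / 2 - b / 2) * I_sq

lemma congr_deriv (h : HasWirtinger f a b z) (ha : a = a') (hb : b = b') :
    HasWirtinger f a' b' z := by
  subst ha hb
  exact h

lemma add (hf : HasWirtinger f a b z) (hg : HasWirtinger g a' b' z) :
    HasWirtinger (fun x => f x + g x) (a + a') (b + b') z := by
  unfold HasWirtinger at *
  refine (HasFDerivAt.add hf hg).congr_fderiv ?_
  module

lemma sub (hf : HasWirtinger f a b z) (hg : HasWirtinger g a' b' z) :
    HasWirtinger (fun x => f x - g x) (a - a') (b - b') z := by
  unfold HasWirtinger at *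
  refine (HasFDerivAt.sub hf hg).congr_fderiv ?_
  module

lemma mul (hf : HasWirtinger f a b z) (hg : HasWirtinger g a' b' z) :
    HasWirtinger (fun x => f x * g x) (a * g z + f z * a') (b * g z + f z * b') z := by
  unfold HasWirtinger at *
  refine (HasFDerivAt.mul hf hg).congr_fderiv ?_
  module

lemma const (c : ℂ) : HasWirtinger (fun _ => c) 0 0 z := by
  unfold HasWirtinger
  exact (hasFDerivAt_const (𝕜 := ℝ) c z).congr_fderiv (by module)

lemma const_mul (c : ℂ) (hf : HasWirtinger f a b z) :
    HasWirtinger (fun x => c * f x) (c * a) (c * b) z :=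
  ((const c).mul hf).congr_deriv (by ring) (by ring)

lemma sq (hf : HasWirtinger f a b z) :
    HasWirtinger (fun x => f x ^ 2) (2 * f z * a) (2 * f z * b) z := by
  simp only [pow_two]
  exact (hf.mul hf).congr_deriv (by ring) (by ring)

lemma id : HasWirtinger (fun x => x) 1 0 z := by
  unfold HasWirtinger
  exact (hasFDerivAt_id (𝕜 := ℝ) z).congr_fderiv (by module)

lemma conj_id : HasWirtinger (fun x => conj x) 0 1 z := by
  unfold HasWirtinger
  exact (conjCLE : ℂ →L[ℝ] ℂ).hasFDerivAt.congr_fderiv (by module)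

lemma log (hz : z ∈ slitPlane) : HasWirtinger (fun x => Complex.log x) z⁻¹ 0 z := by
  unfold HasWirtinger
  refine ((hasDerivAt_log hz).hasFDerivAt.restrictScalars ℝ).congr_fderiv ?_
  ext
  simp [mul_comm]

lemma log_conj (hz : z ∈ slitPlane) :
    HasWirtinger (fun x => Complex.log (conj x)) 0 (conj z)⁻¹ z := by
  unfold HasWirtinger
  have hz' : conj z ∈ slitPlane := by
    rw [mem_slitPlane_iff] at hz ⊢
    simpa using hz
  have h := ((hasDerivAt_log hz').hasFDerivAt.restrictScalars ℝ).comp z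
    ((conjCLE : ℂ →L[ℝ] ℂ).hasFDerivAt (x := z))
  refine h.congr_fderiv ?_
  ext
  simp [mul_comm]

end HasWirtinger

/-- Wirtinger derivatives of the combination of `z² log² z`, `z̄² log² z̄`, `z² log z`,
`z̄² log z̄`, `z²`, `z̄²` and `z̄ z log z - z z̄` from which both shadow functions are built. -/
lemma hasWirtinger_shadow (k A B C D F G : ℂ) {z : ℂ} (hz : z ∈ slitPlane) :
    HasWirtinger (fun z => k * (A * (z ^ 2 * log z ^ 2) + A * (conj z ^ 2 * log (conj z) ^ 2)
        - B * (z ^ 2 * log z) - C * (conj z ^ 2 * log (conj z)) - D * z ^ 2 - F * conj z ^ 2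
        + G * (conj z * z * log z - z * conj z)))
      (k * (2 * A * z * log z ^ 2 + (2 * A - 2 * B) * z * log z - (B + 2 * D) * z
        + G * (conj z * log z)))
      (k * (2 * A * conj z * log (conj z) ^ 2 + (2 * A - 2 * C) * conj z * log (conj z)
        - (C + 2 * F) * conj z + G * (z * log z - z))) z := by
  have h0 : z ≠ 0 := slitPlane_ne_zero hz
  have h0' : conj z ≠ 0 := by simpa using h0
  have L := HasWirtinger.log hz
  have M := HasWirtinger.log_conj hz
  have X : HasWirtinger (fun x => x) 1 0 z := HasWirtinger.id
  have Y : HasWirtinger (fun x => conj x) 0 1 z := HasWirtinger.conj_id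
  refine (((((((((X.sq.mul L.sq).const_mul A).add ((Y.sq.mul M.sq).const_mul A)).sub
    ((X.sq.mul L).const_mul B)).sub ((Y.sq.mul M).const_mul C)).sub (X.sq.const_mul D)).sub
    (Y.sq.const_mul F)).add ((((Y.mul X).mul L).sub (X.mul Y)).const_mul G)).const_mul
    k).congr_deriv ?_ ?_
  · field_simp
    ring
  · field_simp
    ring

/-- The mixed derivative `∂_z ∂_{z̄}` of the shadow combination only sees its last term. -/
lemma wdz_wdzbar_shadow (k A B C D F G : ℂ) {z : ℂ} (hz : z ∈ slitPlane) :
    wdz (wdzbar (fun z => k * (A * (z ^ 2 * log z ^ 2) + A * (conj z ^ 2 * log (conj z) ^ 2)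
        - B * (z ^ 2 * log z) - C * (conj z ^ 2 * log (conj z)) - D * z ^ 2 - F * conj z ^ 2
        + G * (conj z * z * log z - z * conj z)))) z = k * G * log z := by
  have h0 : z ≠ 0 := slitPlane_ne_zero hz
  have L := HasWirtinger.log hz
  have M := HasWirtinger.log_conj hz
  have X : HasWirtinger (fun x => x) 1 0 z := HasWirtinger.id
  have Y : HasWirtinger (fun x => conj x) 0 1 z := HasWirtinger.conj_id
  have key := (((((Y.const_mul (2 * A)).mul M.sq).add ((Y.const_mul (2 * A - 2 * C)).mul M)).sub
    (Y.const_mul (C + 2 * F))).add (((X.mul L).sub X).const_mul G)).const_mul k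
  refine (HasWirtinger.wdz_eq (HasFDerivAt.congr_of_eventuallyEq key ?_)).trans ?_
  · filter_upwards [isOpen_slitPlane.mem_nhds hz] with x hx
    exact (hasWirtinger_shadow k A B C D F G hx).wdzbar_eq
  · field_simp
    ring

lemma mem_slitPlane_of_abs_arg_lt_pi {z : ℂ} (h0 : z ≠ 0) (h : |z.arg| < π) :
    z ∈ slitPlane :=
  mem_slitPlane_iff_arg.2 ⟨fun h' => by rw [h', abs_of_pos Real.pi_pos] at h; exact h.false, h0⟩

lemma log_neg_of_im_pos {z : ℂ} (h : 0 < z.im) : log (-z) = log z - π * I := by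
  simp only [log, norm_neg, arg_neg_eq_arg_sub_pi_of_im_pos h]
  push_cast
  ring

lemma log_neg_of_im_neg {z : ℂ} (h : z.im < 0) : log (-z) = log z + π * I := by
  simp only [log, norm_neg, arg_neg_eq_arg_add_pi_of_im_neg h]
  push_cast
  ring

lemma log_conj_sub_log {z : ℂ} (hz : z ∈ slitPlane) :
    log (conj z) = log z - 2 * z.arg * I := by
  rw [Complex.log_conj _ (mem_slitPlane_iff_arg.1 hz).1]
  simp only [log, map_add, map_mul, conj_ofReal, conj_I]
  ring

lemma conj_mul_exp_two_arg (z : ℂ) :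
    conj z * (Real.cos (2 * z.arg) + Real.sin (2 * z.arg) * I) = z := by
  have h := norm_mul_exp_arg_mul_I z
  have e : (Real.cos (2 * z.arg) + Real.sin (2 * z.arg) * I : ℂ)
      = exp (z.arg * I) * exp (z.arg * I) := by
    rw [← Complex.exp_add, ofReal_cos, ofReal_sin, ← exp_mul_I]
    push_cast
    ring_nf
  have h' : conj z = ‖z‖ * exp (-(z.arg * I)) := by
    conv_lhs => rw [← h]
    rw [map_mul, conj_ofReal, ← exp_conj, map_mul, conj_ofReal, conj_I, mul_neg]
  rw [e, h', ← mul_assoc, mul_assoc (‖z‖ : ℂ), ← Complex.exp_add, neg_add_cancel,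
    Complex.exp_zero, mul_one, h]

lemma mul_exp_neg_two_arg (z : ℂ) :
    z * (Real.cos (2 * z.arg) - Real.sin (2 * z.arg) * I) = conj z := by
  have h := congrArg conj (conj_mul_exp_two_arg z)
  simp only [map_add, map_mul, conj_ofReal, conj_I, conj_conj] at h
  rw [← h]
  ring

/-- The first-order shadow `(ζ⁰₁, η⁰₁)` generated by `−log z/(2π)`
(Proposition `prop:k-0`). -/
theorem stmt13 (ω : ℝ) (hω : ω ∈ Ioo 0 (2 * π))
    (zeta eta : ℂ → ℂ)
    (hzeta : ∀ z : ℂ, (-(2 * π) : ℂ) * zeta z =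
      ((Real.sin ω : ℂ) / (4 * π)) * z ^ 2 * (Complex.log z) ^ 2
      + ((Real.sin ω : ℂ) / (4 * π)) * (conj z) ^ 2 * (Complex.log (conj z)) ^ 2
      - (((Real.sin ω + 2 * π * Real.cos ω : ℝ) : ℂ) / (4 * π)) * z ^ 2 * Complex.log z
      - (((3 * Real.sin ω + 2 * (π - ω) * Real.cos ω : ℝ) : ℂ) / (4 * π))
          * (conj z) ^ 2 * Complex.log (conj z)
      - (1 / 4 : ℂ) * (((π * Real.sin ω - Real.cos ω : ℝ) : ℂ)) * z ^ 2
      + conj z * z * Complex.log z - z * conj z)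
    (heta : ∀ z : ℂ, (-(2 * π) : ℂ) * eta z =
      ((Real.sin ω : ℂ) / (4 * π)) * z ^ 2 * (Complex.log z) ^ 2
      + ((Real.sin ω : ℂ) / (4 * π)) * (conj z) ^ 2 * (Complex.log (conj z)) ^ 2
      - ((Real.sin ω : ℂ) / (4 * π)) * z ^ 2 * Complex.log z
      - (((3 * Real.sin ω - 2 * ω * Real.cos ω : ℝ) : ℂ) / (4 * π))
          * (conj z) ^ 2 * Complex.log (conj z)
      - (1 / 4 : ℂ) * (((3 * Real.cos ω + (2 * ω - π) * Real.sin ω : ℝ) : ℂ))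
          * (conj z) ^ 2) :
    (∀ z ∈ Sminus ω, wdz (wdzbar zeta) z = -(Complex.log z) / (2 * π)) ∧
    (∀ zp ∈ SplusVar ω, wdz (wdzbar eta) zp = 0) ∧
    (∀ z ∈ Gam ω, wdz zeta z + wdz eta (-z) = 0 ∧
      wdzbar zeta z + wdzbar eta (-z) = 0) := by
  obtain ⟨hω0, hω1⟩ := hω
  have hpi : (π : ℂ) ≠ 0 := ofReal_ne_zero.2 Real.pi_ne_zero
  set s : ℝ := Real.sin ω
  set c : ℝ := Real.cos ω
  have hk : (-(2 * π) : ℂ) ≠ 0 := by simp [hpi]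
  have Z : zeta = _ := funext fun z => (eq_inv_mul_iff_mul_eq₀ hk).2 ((hzeta z).trans
    (show _ = (s / (4 * π) : ℂ) * (z ^ 2 * log z ^ 2)
        + (s / (4 * π) : ℂ) * (conj z ^ 2 * log (conj z) ^ 2)
        - ((s + 2 * π * c) / (4 * π) : ℂ) * (z ^ 2 * log z)
        - ((3 * s + 2 * (π - ω) * c) / (4 * π) : ℂ) * (conj z ^ 2 * log (conj z))
        - (1 / 4 * (π * s - c) : ℂ) * z ^ 2 - (0 : ℂ) * conj z ^ 2
        + (1 : ℂ) * (conj z * z * log z - z * conj z) by push_cast; ring))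
  have H : eta = _ := funext fun z => (eq_inv_mul_iff_mul_eq₀ hk).2 ((heta z).trans
    (show _ = (s / (4 * π) : ℂ) * (z ^ 2 * log z ^ 2)
        + (s / (4 * π) : ℂ) * (conj z ^ 2 * log (conj z) ^ 2)
        - (s / (4 * π) : ℂ) * (z ^ 2 * log z)
        - ((3 * s - 2 * ω * c) / (4 * π) : ℂ) * (conj z ^ 2 * log (conj z))
        - (0 : ℂ) * z ^ 2 - (1 / 4 * (3 * c + (2 * ω - π) * s) : ℂ) * conj z ^ 2
        + (0 : ℂ) * (conj z * z * log z - z * conj z) by push_cast; ring))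
  refine ⟨fun z hz => ?_, fun z hz => ?_, fun z hz => ?_⟩
  · rw [Z, wdz_wdzbar_shadow _ _ _ _ _ _ _
      (mem_slitPlane_of_abs_arg_lt_pi hz.1 (by linarith [hz.2]))]
    field_simp
  · rw [H, wdz_wdzbar_shadow _ _ _ _ _ _ _
      (mem_slitPlane_of_abs_arg_lt_pi hz.1 (by linarith [hz.2]))]
    ring
  · obtain ⟨h0, ha⟩ := hz
    have hz : z ∈ slitPlane := mem_slitPlane_of_abs_arg_lt_pi h0 (by linarith)
    have him : z.im = ‖z‖ * Real.sin z.arg := (norm_mul_sin_arg z).symm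
    have hn : 0 < ‖z‖ := norm_pos_iff.2 h0
    have hM := log_conj_sub_log hz
    have e1 := conj_mul_exp_two_arg z
    have e2 := mul_exp_neg_two_arg z
    have hsin : 0 < Real.sin (ω / 2) := Real.sin_pos_of_pos_of_lt_pi (by linarith) (by linarith)
    have harg : ∃ J : ℂ, J ^ 2 = -1 ∧ z.im ≠ 0 ∧ log (-z) = log z - π * J ∧
        log (conj (-z)) = log (conj z) + π * J ∧ log (conj z) = log z - ω * J ∧
        conj z * (c + s * J) = z ∧ z * (c - s * J) = conj z := by
      rcases (abs_eq (by linarith)).1 ha with harg | harg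
      · have hip : 0 < z.im := by rw [him, harg]; positivity
        rw [harg, show 2 * (ω / 2) = ω by ring] at e1 e2
        refine ⟨I, I_sq, hip.ne', log_neg_of_im_pos hip, ?_, ?_, e1, e2⟩
        · rw [map_neg, log_neg_of_im_neg (by simpa using hip)]
        · rw [hM, harg]
          push_cast
          ring
      · have hin : z.im < 0 := by
          rw [him, harg, Real.sin_neg]
          exact mul_neg_of_pos_of_neg hn (neg_neg_of_pos hsin)
        rw [harg, show 2 * -(ω / 2) = -ω by ring, Real.cos_neg, Real.sin_neg, ofReal_neg,
          neg_mul, ← mul_neg] at e1 e2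
        refine ⟨-I, by simp, hin.ne, ?_, ?_, ?_, e1, e2⟩
        · rw [log_neg_of_im_neg hin]
          ring
        · rw [map_neg, log_neg_of_im_pos (by simpa using hin)]
          ring
        · rw [hM, harg]
          push_cast
          ring
    obtain ⟨J, hJ, him', hN, hN', hM, e1, e2⟩ := harg
    have hz' : -z ∈ slitPlane := mem_slitPlane_iff.2 (Or.inr (by simpa using him'))
    rw [Z, H, (hasWirtinger_shadow _ _ _ _ _ _ _ hz).wdz_eq,
      (hasWirtinger_shadow _ _ _ _ _ _ _ hz').wdz_eq,
      (hasWirtinger_shadow _ _ _ _ _ _ _ hz).wdzbar_eq,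
      (hasWirtinger_shadow _ _ _ _ _ _ _ hz').wdzbar_eq, hN', hN, hM]
    simp only [map_neg]
    generalize conj z = w at *
    generalize log z = L at *
    constructor
    · linear_combination (norm := skip) (-(2 * π) : ℂ)⁻¹ * (-L * e2 - s * π / 2 * z * hJ)
      field_simp
      ring
    · linear_combination (norm := skip) (-(2 * π) : ℂ)⁻¹ *
        ((1 - ω * J - (L - ω * J)) * e1 + w * (ω * s - s * π / 2) * hJ)
      field_simp
      ring
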